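/- Let χ₁ be a real-valued, even, nonprincipal, primitive Dirichlet character modulo N > 1, let q be a prime, h an integer with 0 < h < q, x > 0 a real number, and ρ > 0 a real number. Then Σ_{n ≤ x} (x² − n²)^ρ Σ_{r | n} d_{χ₁}(n/r) cos(2πrh/q) = (q^{2ρ+1}/φ(q)) Σ_{n ≤ x/q} ((x/q)² − n²)^ρ 𝒟(n) − (1/φ(q)) Σ_{n ≤ x} (x² − n²)^ρ 𝒟(n) + (1/φ(q)) Σ_{χ even, χ ≠ χ₀ mod q} χ(h) G(χ̄) Σ_{n ≤ x} (x² − n²)^ρ 𝒟_χ(n), where the sum over characters runs over all even nonprincipal Dirichlet characters χ modulo q. -/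

import Mathlib

open scoped Real Classical
open Filter

/-- `d_χ(n) = ∑_{k ∣ n} χ(k)`. -/
noncomputable def divisorSumChar {N : ℕ} (χ : DirichletCharacter ℂ N) (n : ℕ) : ℂ :=
  ∑ k ∈ n.divisors, χ (k : ZMod N)

/-- `𝒟(n) = ∑_{k ∣ n} d_{χ₁}(k)`. -/
noncomputable def scrD {N : ℕ} (χ₁ : DirichletCharacter ℂ N) (n : ℕ) : ℂ :=
  ∑ k ∈ n.divisors, divisorSumChar χ₁ k

/-- `𝒟_χ(n) = ∑_{k ∣ n} d_{χ₁}(k) χ(n/k)`. -/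
noncomputable def scrDchi {N q : ℕ} (χ₁ : DirichletCharacter ℂ N)
    (χ : DirichletCharacter ℂ q) (n : ℕ) : ℂ :=
  ∑ k ∈ n.divisors, divisorSumChar χ₁ k * χ ((n / k : ℕ) : ZMod q)

/-- Gauss sum `G(χ) = ∑_{h=1}^{q-1} χ(h) e^{2πih/q}`. -/
noncomputable def gaussSum' {q : ℕ} (χ : DirichletCharacter ℂ q) : ℂ :=
  ∑ h ∈ Finset.Ico 1 q, χ (h : ZMod q) * Complex.exp (2 * π * Complex.I * h / q)

theorem ZMod.sum_range_natCast {M : Type*} [AddCommMonoid M] (q : ℕ) [NeZero q] (f : ZMod q → M) :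
    ∑ b ∈ Finset.range q, f (b : ZMod q) = ∑ b : ZMod q, f b := by
  refine Finset.sum_nbij' (fun b => (b : ZMod q)) ZMod.val ?_ ?_ ?_ ?_ ?_
  · simp
  · intro b _; simpa using ZMod.val_lt b
  · intro b hb; exact ZMod.val_cast_of_lt (Finset.mem_range.mp hb)
  · intro b _; simp
  · simp

theorem gaussSum'_eq_gaussSum {q : ℕ} [Fact q.Prime] (χ : DirichletCharacter ℂ q) :
    gaussSum' χ = gaussSum χ (ZMod.stdAddChar (N := q)) := by
  have hq : 0 < q := (Fact.out : q.Prime).pos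
  rw [gaussSum, ← ZMod.sum_range_natCast, Finset.range_eq_Ico, Finset.sum_eq_sum_Ico_succ_bot hq,
    gaussSum']
  have h0 : χ ((0 : ℕ) : ZMod q) = 0 := by rw [Nat.cast_zero, MulChar.map_zero]
  rw [h0, zero_mul, zero_add]
  refine Finset.sum_congr rfl fun b _ => ?_
  have := ZMod.stdAddChar_coe (N := q) (b : ℤ)
  push_cast at this
  rw [this]

theorem DirichletCharacter.ringHomComp_starRingEnd {q : ℕ} [NeZero q]
    (χ : DirichletCharacter ℂ q) : χ.ringHomComp (starRingEnd ℂ) = χ⁻¹ := 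
  MulChar.star_eq_inv χ

theorem sum_char_mul_gaussSum_inv {q : ℕ} [Fact q.Prime] {a : ZMod q} (ha : a ≠ 0) :
    ∑ χ : DirichletCharacter ℂ q, χ a * gaussSum χ⁻¹ (ZMod.stdAddChar (N := q)) =
      q.totient * ZMod.stdAddChar a := by
  simp only [gaussSum, Finset.mul_sum]
  rw [Finset.sum_comm, Finset.sum_eq_single a]
  · have h := DirichletCharacter.sum_char_inv_mul_char_eq ℂ (isUnit_iff_ne_zero.mpr ha) a
    rw [if_pos rfl] at h
    rw [← h, Finset.sum_mul]
    refine Finset.sum_congr rfl fun χ _ => ?_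
    rw [MulChar.inv_apply']; ring
  · intro b _ hb
    by_cases hb0 : b = 0
    · simp [hb0, MulChar.map_zero]
    have h := DirichletCharacter.sum_char_inv_mul_char_eq ℂ (isUnit_iff_ne_zero.mpr hb0) a
    rw [if_neg hb] at h
    rw [← zero_mul (ZMod.stdAddChar b), ← h, Finset.sum_mul]
    refine Finset.sum_congr rfl fun χ _ => ?_
    rw [MulChar.inv_apply']; ring
  · simp

theorem sum_even_char_mul_gaussSum_inv {q : ℕ} [Fact q.Prime] {a : ZMod q} (ha : a ≠ 0) :
    ∑ χ : DirichletCharacter ℂ q with χ.Even, χ a * gaussSum χ⁻¹ (ZMod.stdAddChar (N := q)) =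
      q.totient * ((ZMod.stdAddChar a + ZMod.stdAddChar (-a)) / 2) := by
  have h1 := sum_char_mul_gaussSum_inv ha
  have h2 := sum_char_mul_gaussSum_inv (neg_ne_zero.mpr ha)
  rw [mul_div_assoc', mul_add, ← h1, ← h2, ← Finset.sum_add_distrib, Finset.sum_div,
    Finset.sum_filter]
  refine Finset.sum_congr rfl fun χ _ => ?_
  rcases χ.even_or_odd with h | h
  · rw [if_pos h, h.eval_neg]; ring
  · have : ¬ χ.Even := fun h' => by
      have h3 : (1 : ℂ) = -1 := h'.symm.trans h
      norm_num at h3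
    rw [if_neg this, h.eval_neg]; ring

theorem gaussSum_one_stdAddChar {q : ℕ} [Fact q.Prime] :
    gaussSum (1 : DirichletCharacter ℂ q) (ZMod.stdAddChar (N := q)) = -1 := by
  refine gaussSum_one_left fun h => ZMod.isPrimitive_stdAddChar q one_ne_zero ?_
  rw [h]; ext; simp

theorem cos_eq_sum_char {q : ℕ} (hq : q.Prime) {h : ℕ} (hh0 : 0 < h) (hhq : h < q) (r : ℕ) :
    (Real.cos (2 * π * r * h / q) : ℂ) =
      (q / q.totient : ℂ) * (if q ∣ r then 1 else 0) - 1 / q.totient + 1 / q.totient *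
        ∑ χ ∈ Finset.univ.filter (fun χ : DirichletCharacter ℂ q => χ.Even ∧ χ ≠ 1),
          χ (h : ZMod q) * gaussSum' (χ.ringHomComp (starRingEnd ℂ)) * χ (r : ZMod q) := by
  have := Fact.mk hq
  have hφ : (q.totient : ℂ) ≠ 0 := by exact_mod_cast (Nat.totient_pos.mpr hq.pos).ne'
  have hφ' : (q.totient : ℂ) = q - 1 := by
    rw [Nat.totient_prime hq, Nat.cast_sub hq.one_le, Nat.cast_one]
  have hq0 : (q : ℝ) ≠ 0 := by exact_mod_cast hq.ne_zero
  simp only [DirichletCharacter.ringHomComp_starRingEnd, gaussSum'_eq_gaussSum]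
  split_ifs with hr
  · have hr0 : (r : ZMod q) = 0 := (ZMod.natCast_eq_zero_iff r q).mpr hr
    have hc : Real.cos (2 * π * r * h / q) = 1 := by
      obtain ⟨m, rfl⟩ := hr
      rw [← Real.cos_nat_mul_two_pi (m * h)]
      congr 1
      push_cast
      field_simp
    rw [hc, hr0, Finset.sum_eq_zero (fun χ _ => by rw [MulChar.map_zero, mul_zero])]
    field_simp
    rw [hφ']; push_cast; ring
  · have hr0 : (r : ZMod q) ≠ 0 := fun h0 => hr ((ZMod.natCast_eq_zero_iff r q).mp h0)
    have hh : (h : ZMod q) ≠ 0 := fun h0 =>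
      (Nat.not_dvd_of_pos_of_lt hh0 hhq) ((ZMod.natCast_eq_zero_iff h q).mp h0)
    have key := sum_even_char_mul_gaussSum_inv (mul_ne_zero hr0 hh)
    have hcos : (Real.cos (2 * π * r * h / q) : ℂ) =
        (ZMod.stdAddChar ((r : ZMod q) * (h : ZMod q)) + ZMod.stdAddChar (-((r : ZMod q) * (h : ZMod q)))) / 2 := by
      have e1 := ZMod.stdAddChar_coe (N := q) (r * h : ℤ)
      have e2 := ZMod.stdAddChar_coe (N := q) (-(r * h) : ℤ)
      push_cast at e1 e2
      rw [e1, e2, Complex.ofReal_cos, Complex.cos]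
      push_cast
      congr 3 <;> ring_nf
    have hs (F : Finset (DirichletCharacter ℂ q)) (hF : ∀ χ, χ ∈ F ↔ χ.Even ∧ χ ≠ 1) :
        ∑ χ ∈ F, χ (h : ZMod q) * gaussSum χ⁻¹ (ZMod.stdAddChar (N := q)) * χ (r : ZMod q) =
        ∑ χ : DirichletCharacter ℂ q with χ.Even,
          χ ((r : ZMod q) * (h : ZMod q)) * gaussSum χ⁻¹ (ZMod.stdAddChar (N := q)) + 1 := by
      have h1 : (1 : DirichletCharacter ℂ q) ∈
          (Finset.univ.filter fun χ : DirichletCharacter ℂ q => χ.Even) :=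
        Finset.mem_filter.mpr ⟨Finset.mem_univ _, MulChar.one_apply isUnit_one.neg⟩
      rw [← Finset.sum_erase_add _ _ h1, inv_one, gaussSum_one_stdAddChar,
        MulChar.one_apply (isUnit_iff_ne_zero.mpr (mul_ne_zero hr0 hh)), one_mul,
        neg_add_cancel_right]
      refine Finset.sum_congr (by ext; simp [hF, and_comm]) fun χ _ => ?_
      rw [map_mul]; ring
    rw [hs _ fun χ => by simp, key, ← hcos]
    field_simp
    ring

theorem sum_divisors_divisorSumChar_ite {N : ℕ} (χ₁ : DirichletCharacter ℂ N) {q : ℕ} (hq : 0 < q)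
    {n : ℕ} (hn : n ≠ 0) :
    ∑ r ∈ n.divisors, divisorSumChar χ₁ (n / r) * (if q ∣ r then 1 else 0) =
      if q ∣ n then scrD χ₁ (n / q) else 0 := by
  simp only [mul_ite, mul_one, mul_zero]
  rw [← Finset.sum_filter]
  split_ifs with hqn
  · obtain ⟨m, rfl⟩ := hqn
    have hm : m ≠ 0 := right_ne_zero_of_mul hn
    rw [Nat.mul_div_cancel_left m hq, scrD, ← Nat.sum_div_divisors]
    symm
    refine Finset.sum_nbij (fun r => q * r) ?_ ?_ ?_ ?_
    · intro r hr
      simp only [Finset.mem_filter, Nat.mem_divisors]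
      exact ⟨⟨Nat.mul_dvd_mul_left q (Nat.dvd_of_mem_divisors hr), hn⟩, dvd_mul_right q r⟩
    · intro a _ b _ hab
      exact Nat.eq_of_mul_eq_mul_left hq hab
    · rintro r hr
      simp only [Finset.coe_filter, Nat.mem_divisors, Set.mem_ofPred_eq] at hr
      obtain ⟨⟨hr, -⟩, s, rfl⟩ := hr
      exact ⟨s, by simpa [hm] using Nat.dvd_of_mul_dvd_mul_left hq hr, rfl⟩
    · intro r _
      rw [Nat.mul_div_mul_left _ _ hq]
  · refine Finset.sum_eq_zero fun r hr => ?_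
    rw [Finset.mem_filter] at hr
    exact absurd (hr.2.trans (Nat.dvd_of_mem_divisors hr.1)) hqn

theorem scrDchi_eq_sum {N q : ℕ} (χ₁ : DirichletCharacter ℂ N) (χ : DirichletCharacter ℂ q)
    (n : ℕ) :
    scrDchi χ₁ χ n = ∑ r ∈ n.divisors, divisorSumChar χ₁ (n / r) * χ (r : ZMod q) := by
  rw [scrDchi, ← Nat.sum_div_divisors]
  refine Finset.sum_congr rfl fun r hr => ?_
  rw [Nat.div_div_self (Nat.dvd_of_mem_divisors hr) (Nat.mem_divisors.mp hr).2]

theorem sum_divisors_divisorSumChar_mul_cos {N : ℕ} (χ₁ : DirichletCharacter ℂ N) {q : ℕ}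
    (hq : q.Prime) {h : ℕ} (hh0 : 0 < h) (hhq : h < q) {n : ℕ} (hn : n ≠ 0) :
    ∑ r ∈ n.divisors, divisorSumChar χ₁ (n / r) * (Real.cos (2 * π * r * h / q) : ℂ) =
      (q / q.totient : ℂ) * (if q ∣ n then scrD χ₁ (n / q) else 0)
        - 1 / q.totient * scrD χ₁ n + 1 / q.totient *
        ∑ χ ∈ Finset.univ.filter (fun χ : DirichletCharacter ℂ q => χ.Even ∧ χ ≠ 1),
          χ (h : ZMod q) * gaussSum' (χ.ringHomComp (starRingEnd ℂ)) * scrDchi χ₁ χ n := by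
  simp only [scrDchi_eq_sum, cos_eq_sum_char hq hh0 hhq]
  rw [← sum_divisors_divisorSumChar_ite χ₁ hq.pos hn, scrD,
    ← Nat.sum_div_divisors n (divisorSumChar χ₁)]
  simp only [Finset.mul_sum]
  rw [Finset.sum_comm, ← Finset.sum_sub_distrib, ← Finset.sum_add_distrib]
  refine Finset.sum_congr rfl fun r _ => ?_
  rw [mul_add, mul_sub, Finset.mul_sum]
  congr 1
  · ring
  · exact Finset.sum_congr rfl fun χ _ => by ring

theorem sum_Icc_floor_ite_dvd {M : Type*} [AddCommMonoid M] {q : ℕ} (hq : 0 < q) (x : ℝ)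
    (f : ℕ → M) :
    ∑ n ∈ Finset.Icc 1 ⌊x⌋₊, (if q ∣ n then f n else 0) =
      ∑ n ∈ Finset.Icc 1 ⌊x / q⌋₊, f (q * n) := by
  rw [← Finset.sum_filter, Nat.floor_div_natCast]
  symm
  refine Finset.sum_nbij (fun n => q * n) ?_ ?_ ?_ ?_
  · intro n hn
    rw [Finset.mem_Icc, Nat.le_div_iff_mul_le hq] at hn
    simp only [Finset.mem_filter, Finset.mem_Icc]
    exact ⟨⟨Nat.mul_pos hq hn.1, by rw [mul_comm]; exact hn.2⟩, dvd_mul_right q n⟩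
  · intro a _ b _ hab
    exact Nat.eq_of_mul_eq_mul_left hq hab
  · rintro n hn
    simp only [Finset.coe_filter, Finset.mem_Icc, Set.mem_ofPred_eq] at hn
    obtain ⟨⟨h1, h2⟩, m, rfl⟩ := hn
    refine ⟨m, ?_, rfl⟩
    simp only [Finset.coe_Icc, Set.mem_Icc, Nat.le_div_iff_mul_le hq]
    exact ⟨Nat.pos_of_mul_pos_left h1, by rwa [mul_comm]⟩
  · intro n _; rfl

theorem sq_sub_sq_mul_rpow {q : ℝ} (hq : 0 < q) (x m ρ : ℝ) (hm : 0 ≤ (x / q) ^ 2 - m ^ 2) :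
    (x ^ 2 - (q * m) ^ 2) ^ ρ = q ^ (2 * ρ) * ((x / q) ^ 2 - m ^ 2) ^ ρ := by
  rw [Real.rpow_mul hq.le, Real.rpow_two, ← Real.mul_rpow (sq_nonneg q) hm]
  congr 1
  field_simp

theorem statement12 (N : ℕ) [NeZero N] (hN : 1 < N) (χ₁ : DirichletCharacter ℂ N)
    (hreal : ∀ a : ZMod N, (χ₁ a).im = 0) (heven₁ : χ₁.Even) (hnp₁ : χ₁ ≠ 1)
    (hprim₁ : χ₁.IsPrimitive)
    (q : ℕ) (hq : q.Prime) (h : ℕ) (hh0 : 0 < h) (hhq : h < q)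
    (x : ℝ) (hx : 0 < x) (ρ : ℝ) (hρ : 0 < ρ) :
    ∑ n ∈ Finset.Icc 1 ⌊x⌋₊, (((x ^ 2 - (n : ℝ) ^ 2) ^ ρ : ℝ) : ℂ) *
        ∑ r ∈ n.divisors, divisorSumChar χ₁ (n / r) * (Real.cos (2 * π * r * h / q) : ℂ)
    = (((q : ℝ) ^ (2 * ρ + 1) / (q.totient : ℝ) : ℝ) : ℂ) *
        ∑ n ∈ Finset.Icc 1 ⌊x / q⌋₊, ((((x / q) ^ 2 - (n : ℝ) ^ 2) ^ ρ : ℝ) : ℂ) * scrD χ₁ n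
      - (1 / (q.totient : ℂ)) *
        ∑ n ∈ Finset.Icc 1 ⌊x⌋₊, (((x ^ 2 - (n : ℝ) ^ 2) ^ ρ : ℝ) : ℂ) * scrD χ₁ n
      + (1 / (q.totient : ℂ)) *
        ∑ χ ∈ Finset.univ.filter (fun χ : DirichletCharacter ℂ q => χ.Even ∧ χ ≠ 1),
          χ (h : ZMod q) * gaussSum' (χ.ringHomComp (starRingEnd ℂ)) *
          ∑ n ∈ Finset.Icc 1 ⌊x⌋₊, (((x ^ 2 - (n : ℝ) ^ 2) ^ ρ : ℝ) : ℂ) * scrDchi χ₁ χ n := by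
  have hq0 : (0 : ℝ) < q := by exact_mod_cast hq.pos
  have hsum : ∑ n ∈ Finset.Icc 1 ⌊x⌋₊, (((x ^ 2 - (n : ℝ) ^ 2) ^ ρ : ℝ) : ℂ) *
        ((q / q.totient : ℂ) * (if q ∣ n then scrD χ₁ (n / q) else 0)) =
      (((q : ℝ) ^ (2 * ρ + 1) / (q.totient : ℝ) : ℝ) : ℂ) * ∑ n ∈ Finset.Icc 1 ⌊x / q⌋₊,
        ((((x / q) ^ 2 - (n : ℝ) ^ 2) ^ ρ : ℝ) : ℂ) * scrD χ₁ n := by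
    simp only [mul_ite, mul_zero]
    rw [sum_Icc_floor_ite_dvd hq.pos, Finset.mul_sum]
    refine Finset.sum_congr rfl fun n hn => ?_
    have hnx : (n : ℝ) ≤ x / q :=
      (Nat.le_floor_iff (by positivity)).mp (Finset.mem_Icc.mp hn).2
    rw [Nat.mul_div_cancel_left n hq.pos, Nat.cast_mul, sq_sub_sq_mul_rpow hq0 x n ρ
      (sub_nonneg.mpr (pow_le_pow_left₀ n.cast_nonneg hnx 2)), Real.rpow_add_one hq0.ne']
    push_cast
    ring
  rw [← hsum]
  simp only [Finset.mul_sum]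
  rw [Finset.sum_comm, ← Finset.sum_sub_distrib, ← Finset.sum_add_distrib]
  refine Finset.sum_congr rfl fun n hn => ?_
  rw [← Finset.mul_sum, sum_divisors_divisorSumChar_mul_cos χ₁ hq hh0 hhq
    (Nat.one_le_iff_ne_zero.mp (Finset.mem_Icc.mp hn).1), mul_add, mul_sub, Finset.mul_sum,
    Finset.mul_sum]
  congr 1
  · ring
  · exact Finset.sum_congr rfl fun χ _ => by ring
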